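/- Let M ⊆ ℤ^m be an affine monoid. Then M is seminormal if and only if for every face F of cone(M), gp(M ∩ F) ∩ relint(F) ⊆ M. -/

import Mathlib

noncomputable section

/-- The canonical embedding `ℤ^m → ℝ^m`. -/
def toR {m : ℕ} (x : Fin m → ℤ) : Fin m → ℝ := fun i => (x i : ℝ)

/-- The subgroup of `ℤ^m` generated by a submonoid `M`. -/
def gp {m : ℕ} (M : AddSubmonoid (Fin m → ℤ)) : AddSubgroup (Fin m → ℤ) :=
  AddSubgroup.closure (M : Set (Fin m → ℤ))

/-- The convex cone in `ℝ^m` generated by `M`: all nonnegative real combinations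
of elements of `M`. -/
def coneM {m : ℕ} (M : AddSubmonoid (Fin m → ℤ)) : Set (Fin m → ℝ) :=
  {x | ∃ (n : ℕ) (c : Fin n → ℝ) (v : Fin n → (Fin m → ℤ)),
    (∀ i, 0 ≤ c i) ∧ (∀ i, v i ∈ M) ∧ x = ∑ i, c i • toR (v i)}

/-- Faces of `coneM M`: the cone itself, or an intersection with a supporting
hyperplane given by a linear form nonnegative on the cone. -/
def IsFace {m : ℕ} (M : AddSubmonoid (Fin m → ℤ)) (F : Set (Fin m → ℝ)) : Prop :=
  F = coneM M ∨ ∃ α : (Fin m → ℝ) →ₗ[ℝ] ℝ,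
    (∀ x ∈ coneM M, 0 ≤ α x) ∧ F = {x ∈ coneM M | α x = 0}

/-- A facet: a maximal proper face. -/
def IsFacet {m : ℕ} (M : AddSubmonoid (Fin m → ℤ)) (F : Set (Fin m → ℝ)) : Prop :=
  IsFace M F ∧ F ≠ coneM M ∧ ∀ G, IsFace M G → F ⊆ G → G = F ∨ G = coneM M

/-- The subgroup `gp(M ∩ F)` of `ℤ^m` generated by the elements of `M` lying
in the face `F`. -/
def gpF {m : ℕ} (M : AddSubmonoid (Fin m → ℤ)) (F : Set (Fin m → ℝ)) :
    AddSubgroup (Fin m → ℤ) :=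
  AddSubgroup.closure {a : Fin m → ℤ | a ∈ M ∧ toR a ∈ F}

/-- `M` is seminormal: `z ∈ gp(M)`, `2z ∈ M`, `3z ∈ M` imply `z ∈ M`. -/
def Seminormal {m : ℕ} (M : AddSubmonoid (Fin m → ℤ)) : Prop :=
  ∀ z ∈ gp M, 2 • z ∈ M → 3 • z ∈ M → z ∈ M

/-- `M` is normal: `z ∈ gp(M)`, `kz ∈ M` for some `k ≥ 1` imply `z ∈ M`. -/
def IsNormal {m : ℕ} (M : AddSubmonoid (Fin m → ℤ)) : Prop :=
  ∀ z ∈ gp M, (∃ k : ℕ, 0 < k ∧ k • z ∈ M) → z ∈ M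

/-- `M` is positive: `0` is the only invertible element. -/
def Positive {m : ℕ} (M : AddSubmonoid (Fin m → ℤ)) : Prop :=
  ∀ a ∈ M, -a ∈ M → a = 0

/-- The localization monoid `M_F` of `M` at a face `F`:
elements `a ∈ gp(M)` with `a + b ∈ M` for some `b ∈ M ∩ F`. -/
def locM {m : ℕ} (M : AddSubmonoid (Fin m → ℤ)) (F : Set (Fin m → ℝ)) :
    Set (Fin m → ℤ) :=
  {a | a ∈ gp M ∧ ∃ b, b ∈ M ∧ toR b ∈ F ∧ a + b ∈ M}

section Farkas

variable {ι V : Type*} [AddCommGroup V] [Module ℝ V]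

/-- **Farkas' lemma**: a vector on which every linear form nonnegative on a finite family is
nonnegative is a nonnegative combination of the family. -/
theorem exists_nonneg_combination_of_forall_dual [DecidableEq ι] (s : Finset ι) (v : ι → V) (b : V)
    (h : ∀ f : Module.Dual ℝ V, (∀ i ∈ s, 0 ≤ f (v i)) → 0 ≤ f b) :
    ∃ c : ι → ℝ, (∀ i ∈ s, 0 ≤ c i) ∧ b = ∑ i ∈ s, c i • v i := by
  induction s using Finset.induction_on generalizing v b with
  | empty =>
    refine ⟨0, by simp, ?_⟩
    rw [Finset.sum_empty, ← Module.forall_dual_apply_eq_zero_iff ℝ]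
    intro f
    have h₁ := h f (by simp)
    have h₂ := h (-f) (by simp)
    simp only [LinearMap.neg_apply] at h₂
    linarith
  | insert a s ha ih =>
    by_cases hb : ∀ f : Module.Dual ℝ V, (∀ i ∈ s, 0 ≤ f (v i)) → 0 ≤ f b
    · obtain ⟨c, hc, rfl⟩ := ih v b hb
      refine ⟨fun i => if i = a then 0 else c i, fun i hi => ?_, ?_⟩
      · dsimp only
        split_ifs with hia
        · exact le_rfl
        · exact hc i (Finset.mem_of_mem_insert_of_ne hi hia)
      · rw [Finset.sum_insert ha]
        simp only [if_true, zero_smul, zero_add]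
        refine Finset.sum_congr rfl fun i hi => ?_
        rw [if_neg (ne_of_mem_of_not_mem hi ha)]
    push Not at hb
    obtain ⟨g, hg, hgb⟩ := hb
    have hga : g (v a) < 0 := by
      by_contra! hga
      exact hgb.not_ge (h g (by simpa using ⟨hga, hg⟩))
    obtain ⟨c, hc, hcb⟩ := ih (fun i => v i - (g (v i) / g (v a)) • v a)
      (b - (g b / g (v a)) • v a) (fun f hf => by
        have := h (f - (f (v a) / g (v a)) • g) (by
          intro i hi
          rcases Finset.mem_insert.1 hi with rfl | hi
          · simp [div_mul_cancel₀ _ hga.ne]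
          · have := hf i hi
            simp only [map_sub, map_smul, smul_eq_mul, LinearMap.sub_apply,
              LinearMap.smul_apply] at this ⊢
            convert this using 2
            ring)
        simp only [map_sub, map_smul, smul_eq_mul, LinearMap.sub_apply,
          LinearMap.smul_apply] at this ⊢
        convert this using 2
        ring)
    refine ⟨fun i => if i = a then g b / g (v a) - ∑ j ∈ s, c j * (g (v j) / g (v a)) else c i,
      fun i hi => ?_, ?_⟩
    · dsimp only
      split_ifs with hia
      · have h₁ : 0 ≤ g b / g (v a) := div_nonneg_of_nonpos hgb.le hga.le
        have h₂ : ∑ j ∈ s, c j * (g (v j) / g (v a)) ≤ 0 := Finset.sum_nonpos fun j hj =>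
          mul_nonpos_of_nonneg_of_nonpos (hc j hj) (div_nonpos_of_nonneg_of_nonpos (hg j hj) hga.le)
        linarith
      · exact hc i (Finset.mem_of_mem_insert_of_ne hi hia)
    · rw [Finset.sum_insert ha]
      have : ∑ i ∈ s, (if i = a then g b / g (v a) - ∑ j ∈ s, c j * (g (v j) / g (v a)) else c i) •
          v i = ∑ i ∈ s, c i • v i := Finset.sum_congr rfl fun i hi => by
        rw [if_neg (ne_of_mem_of_not_mem hi ha)]
      rw [this]
      simp only [if_true]
      simp only [smul_sub, Finset.sum_sub_distrib, smul_smul, ← Finset.sum_smul] at hcb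
      rw [sub_smul, ← sub_eq_zero, ← sub_eq_zero.2 hcb]
      abel

end Farkas

section Rational

/-- There is a `ℚ`-linear form on `ℝ` that is positive at finitely many given positive reals. -/
theorem exists_rat_dual_pos {ι : Type*} (s : Finset ι) (c : ι → ℝ) (hc : ∀ i ∈ s, 0 < c i) :
    ∃ φ : ℝ →ₗ[ℚ] ℚ, ∀ i ∈ s, 0 < φ (c i) := by
  let B := Module.Basis.ofVectorSpace ℚ ℝ
  let U : Set (Module.Basis.ofVectorSpaceIndex ℚ ℝ → ℝ) :=
    {r | ∀ i ∈ s, 0 < ∑ j ∈ (B.repr (c i)).support, (B.repr (c i) j : ℝ) * r j}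
  have hU : IsOpen U := by
    have : U = ⋂ i ∈ s, {r | 0 < ∑ j ∈ (B.repr (c i)).support, (B.repr (c i) j : ℝ) * r j} := by
      ext; simp [U]
    rw [this]
    exact isOpen_biInter_finset fun i _ => isOpen_lt continuous_const (by fun_prop)
  have hB : (fun j => B j) ∈ U := fun i hi => by
    have := B.linearCombination_repr (c i)
    rw [Finsupp.linearCombination_apply, Finsupp.sum] at this
    simp only [Rat.smul_def] at this
    rw [this]
    exact hc i hi
  obtain ⟨r, hr⟩ := (DenseRange.piMap fun _ : Module.Basis.ofVectorSpaceIndex ℚ ℝ =>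
    Rat.denseRange_cast (𝕜 := ℝ)).exists_mem_open hU ⟨_, hB⟩
  refine ⟨B.constr ℚ r, fun i hi => ?_⟩
  have := hr i hi
  rw [Module.Basis.constr_apply, Finsupp.sum]
  simp only [Pi.map_apply] at this
  simp only [smul_eq_mul]
  exact_mod_cast this

/-- Finitely many nonnegative reals can be replaced by naturals with the same support, keeping
all integral linear relations. -/
theorem exists_nat_relations {ι : Type*} [Fintype ι] (c : ι → ℝ) (hc : ∀ i, 0 ≤ c i) :
    ∃ g : ι → ℕ, (∀ i, 0 < c i → 0 < g i) ∧
      ∀ a : ι → ℤ, ∑ i, a i * c i = 0 → ∑ i, a i * (g i : ℤ) = 0 := by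
  classical
  obtain ⟨φ, hφ⟩ := exists_rat_dual_pos (Finset.univ.filter fun i => 0 < c i) c (by simp)
  simp only [Finset.mem_filter, Finset.mem_univ, true_and] at hφ
  have hφ₀ : ∀ i, 0 ≤ φ (c i) := fun i => by
    rcases (hc i).eq_or_lt with h | h
    · simp [← h]
    · exact (hφ i h).le
  let D : ℕ := ∏ i, (φ (c i)).den
  have hD : (0 : ℚ) < D := by
    exact_mod_cast Finset.prod_pos fun i _ => (φ (c i)).den_pos
  have hg : ∀ i, ∃ k : ℕ, (k : ℚ) = D * φ (c i) := fun i => by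
    obtain ⟨e, he⟩ : (φ (c i)).den ∣ D := Finset.dvd_prod_of_mem _ (Finset.mem_univ i)
    obtain ⟨n, hn⟩ := Int.eq_ofNat_of_zero_le (Rat.num_nonneg.2 (hφ₀ i))
    refine ⟨e * n, ?_⟩
    have h₁ : φ (c i) * (φ (c i)).den = n := by
      rw [Rat.mul_den_eq_num, hn]; simp
    rw [he]
    push_cast
    rw [← h₁]
    ring
  choose g hg using hg
  refine ⟨g, fun i hi => ?_, fun a ha => ?_⟩
  · have : (0 : ℚ) < g i := by
      rw [hg]
      exact mul_pos hD (hφ i hi)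
    exact_mod_cast this
  · have h₁ := congrArg φ ha
    simp only [← zsmul_eq_mul, map_sum, map_zsmul, map_zero] at h₁
    have h₂ : ∑ i, (a i : ℚ) * (g i : ℚ) = 0 := by
      simp only [hg, zsmul_eq_mul] at h₁ ⊢
      rw [← mul_zero (D : ℚ), ← h₁, Finset.mul_sum]
      exact Finset.sum_congr rfl fun i _ => by ring
    exact_mod_cast h₂

end Rational

section Cone

variable {m : ℕ} {M : AddSubmonoid (Fin m → ℤ)}

@[simp] theorem toR_zero : toR (0 : Fin m → ℤ) = 0 := by ext; simp [toR]

@[simp] theorem toR_add (a b : Fin m → ℤ) : toR (a + b) = toR a + toR b := by ext; simp [toR]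

@[simp] theorem toR_nsmul (k : ℕ) (a : Fin m → ℤ) : toR (k • a) = (k : ℝ) • toR a := by
  ext; simp [toR]

theorem toR_mem_coneM {a : Fin m → ℤ} (ha : a ∈ M) : toR a ∈ coneM M :=
  ⟨1, fun _ => 1, fun _ => a, by simp, by simpa, by simp⟩

theorem dual_nonneg_of_mem_coneM {f : (Fin m → ℝ) →ₗ[ℝ] ℝ} (hf : ∀ a ∈ M, 0 ≤ f (toR a))
    {x : Fin m → ℝ} (hx : x ∈ coneM M) : 0 ≤ f x := by
  obtain ⟨n, c, v, hc, hv, rfl⟩ := hx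
  simp only [map_sum, map_smul, smul_eq_mul]
  exact Finset.sum_nonneg fun i _ => mul_nonneg (hc i) (hf _ (hv i))

theorem dual_nonneg_of_closure {S : Set (Fin m → ℤ)} (hS : AddSubmonoid.closure S = M)
    {f : (Fin m → ℝ) →ₗ[ℝ] ℝ} (hf : ∀ s ∈ S, 0 ≤ f (toR s)) {a : Fin m → ℤ} (ha : a ∈ M) :
    0 ≤ f (toR a) := by
  subst hS
  induction ha using AddSubmonoid.closure_induction with
  | mem x hx => exact hf x hx
  | zero => simp
  | add x y _ _ hx hy => simpa using add_nonneg hx hy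

theorem sum_mem_coneM {ι : Type*} (s : Finset ι) (c : ι → ℝ) (v : ι → Fin m → ℤ)
    (hc : ∀ i ∈ s, 0 ≤ c i) (hv : ∀ i ∈ s, v i ∈ M) : ∑ i ∈ s, c i • toR (v i) ∈ coneM M :=
  ⟨s.card, fun j => c (s.equivFin.symm j), fun j => v (s.equivFin.symm j),
    fun j => hc _ (s.equivFin.symm j).2, fun j => hv _ (s.equivFin.symm j).2, by
    rw [← Finset.sum_coe_sort s]
    exact (s.equivFin.symm.sum_comp fun i : s => c i • toR (v i)).symm⟩

theorem exists_combination_of_mem_coneM {S : Finset (Fin m → ℤ)}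
    (hS : AddSubmonoid.closure (S : Set (Fin m → ℤ)) = M) {x : Fin m → ℝ}
    (hx : ∀ f : (Fin m → ℝ) →ₗ[ℝ] ℝ, (∀ a ∈ M, 0 ≤ f (toR a)) → 0 ≤ f x) :
    ∃ c : (Fin m → ℤ) → ℝ, (∀ s ∈ S, 0 ≤ c s) ∧ x = ∑ s ∈ S, c s • toR s := by
  classical
  exact exists_nonneg_combination_of_forall_dual S toR x fun f hf =>
    hx f fun _ ha => dual_nonneg_of_closure hS hf ha

theorem mem_coneM_iff_forall_dual (hFG : M.FG) {x : Fin m → ℝ} :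
    x ∈ coneM M ↔ ∀ f : (Fin m → ℝ) →ₗ[ℝ] ℝ, (∀ a ∈ M, 0 ≤ f (toR a)) → 0 ≤ f x := by
  refine ⟨fun hx f hf => dual_nonneg_of_mem_coneM hf hx, fun hx => ?_⟩
  obtain ⟨S, hS⟩ := hFG
  obtain ⟨c, hc, rfl⟩ := exists_combination_of_mem_coneM hS hx
  exact sum_mem_coneM S c id hc fun s hs => hS ▸ AddSubmonoid.subset_closure hs

theorem IsFace.subset {F : Set (Fin m → ℝ)} (hF : IsFace M F) : F ⊆ coneM M := by
  rcases hF with rfl | ⟨α, -, rfl⟩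
  · exact subset_rfl
  · exact fun x hx => hx.1

theorem IsFace.toR_zero_mem {F : Set (Fin m → ℝ)} (hF : IsFace M F) :
    toR (0 : Fin m → ℤ) ∈ F := by
  rcases hF with rfl | ⟨α, -, rfl⟩
  · exact toR_mem_coneM M.zero_mem
  · exact ⟨toR_mem_coneM M.zero_mem, by simp⟩

theorem IsFace.toR_add_mem {F : Set (Fin m → ℝ)} (hF : IsFace M F) {a b : Fin m → ℤ}
    (ha : a ∈ M) (hb : b ∈ M) (haF : toR a ∈ F) (hbF : toR b ∈ F) : toR (a + b) ∈ F := by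
  rcases hF with rfl | ⟨α, -, rfl⟩
  · exact toR_mem_coneM (M.add_mem ha hb)
  · exact ⟨toR_mem_coneM (M.add_mem ha hb), by simp [haF.2, hbF.2]⟩

theorem IsFace.exists_sub_of_mem_gpF {F : Set (Fin m → ℝ)} (hF : IsFace M F) {z : Fin m → ℤ}
    (hz : z ∈ gpF M F) : ∃ a ∈ M, ∃ b ∈ M, toR b ∈ F ∧ toR a ∈ F ∧ z = a - b := by
  unfold gpF at hz
  induction hz using AddSubgroup.closure_induction with
  | mem x hx => exact ⟨x, hx.1, 0, M.zero_mem, hF.toR_zero_mem, hx.2, by simp⟩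
  | zero => exact ⟨0, M.zero_mem, 0, M.zero_mem, hF.toR_zero_mem, hF.toR_zero_mem, by simp⟩
  | add x y _ _ hx hy =>
    obtain ⟨a, ha, b, hb, hbF, haF, rfl⟩ := hx
    obtain ⟨a', ha', b', hb', hbF', haF', rfl⟩ := hy
    exact ⟨a + a', M.add_mem ha ha', b + b', M.add_mem hb hb', hF.toR_add_mem hb hb' hbF hbF',
      hF.toR_add_mem ha ha' haF haF', by abel⟩
  | neg x _ hx =>
    obtain ⟨a, ha, b, hb, hbF, haF, rfl⟩ := hx
    exact ⟨b, hb, a, ha, haF, hbF, by abel⟩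

theorem exists_pos_sub_smul_mem_of_mem_intrinsicInterior {V : Type*} [NormedAddCommGroup V]
    [NormedSpace ℝ V] {F : Set V} {x y : V} (h₀ : (0 : V) ∈ F) (hy : y ∈ F)
    (hx : x ∈ intrinsicInterior ℝ F) : ∃ ε : ℝ, 0 < ε ∧ x - ε • y ∈ F := by
  obtain ⟨x', hx', rfl⟩ := mem_intrinsicInterior.1 hx
  have hmem : ∀ t : ℝ, (x' : V) - t • y ∈ affineSpan ℝ F := fun t => by
    have := AffineSubspace.smul_vsub_vadd_mem (affineSpan ℝ F) t (subset_affineSpan ℝ F h₀)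
      (subset_affineSpan ℝ F hy) x'.2
    simpa [sub_eq_neg_add] using this
  let p : ℝ → affineSpan ℝ F := fun t => ⟨x' - t • y, hmem t⟩
  have hp : Continuous p := by
    unfold p
    fun_prop
  have hp₀ : p 0 = x' := by simp [p]
  have : ∀ᶠ t in nhds (0 : ℝ), p t ∈ ((↑) ⁻¹' F : Set (affineSpan ℝ F)) :=
    hp.continuousAt.eventually_mem (by rw [hp₀]; exact mem_interior_iff_mem_nhds.1 hx')
  obtain ⟨ε, hε, hεF⟩ := ((this.filter_mono nhdsWithin_le_nhds).and
    (self_mem_nhdsWithin (s := Set.Ioi (0 : ℝ)))).exists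
  exact ⟨ε, hεF, hε⟩

theorem exists_nsmul_eq_add_nsmul {z b : Fin m → ℤ} {ε : ℝ} (hε : 0 < ε)
    (h : toR z - ε • toR b ∈ coneM M) :
    ∃ p q : ℕ, 0 < p ∧ 0 < q ∧ ∃ a ∈ M, p • z = a + q • b := by
  obtain ⟨n, c, v, hc, hv, h⟩ := h
  obtain ⟨g, hg, hrel⟩ := exists_nat_relations
    (fun i : Option (Option (Fin n)) => i.elim 1 fun i => i.elim ε c) (by
      rintro (_ | _ | i)
      · simp
      · exact hε.le
      · exact hc i)
  refine ⟨g none, g (some none), hg _ (by simp), hg _ (by simpa),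
    ∑ i, g (some (some i)) • v i, M.sum_mem fun i _ => M.nsmul_mem (hv i) _, ?_⟩
  ext k
  have h₁ := congrFun h k
  simp only [toR, Pi.sub_apply, Pi.smul_apply, smul_eq_mul, Finset.sum_apply] at h₁
  have h₂ := hrel (fun i => i.elim (-z k) fun i => i.elim (b k) fun i => v i k) (by
    simp only [Fintype.sum_option, Option.elim]
    push_cast
    simp only [mul_comm (v _ _ : ℝ), ← h₁]
    ring)
  simp only [Fintype.sum_option, Option.elim] at h₂
  simp only [Pi.add_apply, Pi.smul_apply, Finset.sum_apply, nsmul_eq_mul, Pi.mul_apply,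
    Pi.natCast_apply]
  simp only [mul_comm (v _ _ : ℤ)] at h₂
  linarith

theorem nsmul_mem_of_nsmul_eq_add_nsmul {a b c : Fin m → ℤ} (ha : a ∈ M) (hb : b ∈ M) (hc : c ∈ M)
    {p q : ℕ} (hp : 0 < p) (hq : 0 < q) (h : p • (a - b) = c + q • b) {k : ℕ} (hk : p * p ≤ k) :
    k • (a - b) ∈ M := by
  obtain ⟨d, hd⟩ : ∃ d, k / p * q = k % p + d := Nat.exists_eq_add_of_le <| by
    have h₁ : p ≤ k / p := (Nat.le_div_iff_mul_le hp).2 hk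
    have h₂ := Nat.mod_lt k hp
    nlinarith
  have : k • (a - b) = (k / p) • c + (k % p) • a + d • b := by
    conv_lhs => rw [← Nat.div_add_mod' k p]
    rw [add_nsmul, mul_nsmul', h, nsmul_add, smul_smul, hd, add_nsmul, nsmul_sub]
    abel
  rw [this]
  exact M.add_mem (M.add_mem (M.nsmul_mem hc _) (M.nsmul_mem ha _)) (M.nsmul_mem hb _)

theorem Seminormal.mem_of_forall_nsmul_mem (hM : Seminormal M) {z : Fin m → ℤ} (hz : z ∈ gp M)
    {n : ℕ} (h : ∀ k, n ≤ k → k • z ∈ M) : z ∈ M := by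
  induction n with
  | zero => simpa using h 1 (Nat.zero_le 1)
  | succ n ih =>
    rcases n.eq_zero_or_pos with rfl | hn
    · simpa using h 1 le_rfl
    refine ih fun k hk => ?_
    rcases hk.eq_or_lt with rfl | hk
    · refine hM _ ((gp M).nsmul_mem hz _) ?_ ?_ <;> rw [smul_smul] <;> exact h _ (by omega)
    · exact h k hk

theorem exists_dual_pos_of_forall_sub_smul_notMem (hFG : M.FG) {x : Fin m → ℝ}
    {s : Fin m → ℤ} (hx : x ∈ coneM M) (h : ∀ ε : ℝ, 0 < ε → x - ε • toR s ∉ coneM M) :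
    ∃ α : (Fin m → ℝ) →ₗ[ℝ] ℝ, (∀ a ∈ M, 0 ≤ α (toR a)) ∧ α x = 0 ∧ 0 < α (toR s) := by
  classical
  obtain ⟨S, hS⟩ := id hFG
  by_contra! hα
  obtain ⟨c, hc, hcs⟩ := exists_nonneg_combination_of_forall_dual S.insertNone
    (fun i : Option (Fin m → ℤ) => i.elim (-x) toR) (-toR s) (fun f hf => by
      have hfM : ∀ a ∈ M, 0 ≤ f (toR a) := fun _ ha => dual_nonneg_of_closure hS
        (fun t ht => hf (some t) (Finset.some_mem_insertNone.2 ht)) ha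
      have hfx := hf none (by simp)
      have := hα f hfM (le_antisymm (by simpa using hfx) (dual_nonneg_of_mem_coneM hfM hx))
      simpa using this)
  simp only [Finset.sum_insertNone, Option.elim] at hcs
  have hc₀ : 0 ≤ c none := hc none (by simp)
  have hcone : ∑ t ∈ S, c (some t) • toR t ∈ coneM M :=
    sum_mem_coneM S (fun t => c (some t)) id (fun t ht => hc _ (Finset.some_mem_insertNone.2 ht))
      fun t ht => hS ▸ AddSubmonoid.subset_closure ht
  refine h (1 / (c none + 1)) (by positivity) ((mem_coneM_iff_forall_dual hFG).2 fun f hf => ?_)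
  have h₁ := dual_nonneg_of_mem_coneM hf hcone
  have h₂ := dual_nonneg_of_mem_coneM hf hx
  have h₃ := congrArg f hcs
  simp only [map_neg, map_add, map_smul, smul_eq_mul, map_sub] at h₃ ⊢
  have h₄ : f x - 1 / (c none + 1) * f (toR s) =
      (f x + f (∑ t ∈ S, c (some t) • toR t)) / (c none + 1) := by
    field_simp
    linarith
  rw [h₄]
  positivity

theorem mem_intrinsicInterior_of_eq_sum {V ι : Type*} [NormedAddCommGroup V] [NormedSpace ℝ V]
    [Fintype ι] {F : Set V} (v : ι → V)
    (hF : ∀ y, y ∈ F ↔ ∃ c : ι → ℝ, (∀ i, 0 ≤ c i) ∧ y = ∑ i, c i • v i)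
    (c : ι → ℝ) (hc : ∀ i, 0 < c i) : ∑ i, c i • v i ∈ intrinsicInterior ℝ F := by
  let L := Fintype.linearCombination ℝ v
  have hL : IsOpenMap L.rangeRestrict :=
    LinearMap.isOpenMap_of_finiteDimensional _ L.surjective_rangeRestrict
  have hspan : affineSpan ℝ F ≤ (LinearMap.range L).toAffineSubspace := by
    rw [affineSpan_le]
    intro y hy
    obtain ⟨d, -, rfl⟩ := (hF y).1 hy
    exact ⟨d, rfl⟩
  let i : affineSpan ℝ F → LinearMap.range L := fun y => ⟨y, hspan y.2⟩
  have hi : Continuous i := by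
    unfold i
    fun_prop
  have hU : IsOpen {d : ι → ℝ | ∀ j, 0 < d j} := by
    simp only [Set.ofPred_forall]
    exact isOpen_iInter_of_finite fun j => isOpen_lt continuous_const (continuous_apply j)
  have hmem : ∑ i, c i • v i ∈ F := (hF _).2 ⟨c, fun i => (hc i).le, rfl⟩
  refine mem_intrinsicInterior.2 ⟨⟨_, subset_affineSpan ℝ F hmem⟩, ?_, rfl⟩
  refine mem_interior.2 ⟨i ⁻¹' (L.rangeRestrict '' {d | ∀ j, 0 < d j}), ?_,
    (hL _ hU).preimage hi, ⟨c, hc, Subtype.ext rfl⟩⟩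
  rintro y ⟨d, hd, hdy⟩
  exact (hF y).2 ⟨d, fun j => (hd j).le, (congrArg Subtype.val hdy).symm⟩

/-- Every point of the cone lies in the relative interior of a face. -/
theorem exists_isFace_mem_intrinsicInterior (hFG : M.FG) {x : Fin m → ℝ} (hx : x ∈ coneM M) :
    ∃ α : (Fin m → ℝ) →ₗ[ℝ] ℝ, (∀ y ∈ coneM M, 0 ≤ α y) ∧ α x = 0 ∧
      x ∈ intrinsicInterior ℝ {y ∈ coneM M | α y = 0} := by
  classical
  obtain ⟨S, hS⟩ := id hFG
  have hSM : ∀ s ∈ S, s ∈ M := fun s hs => hS ▸ AddSubmonoid.subset_closure hs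
  let T := S.filter fun s => ∃ ε : ℝ, 0 < ε ∧ x - ε • toR s ∈ coneM M
  have hα : ∀ s, ∃ α : (Fin m → ℝ) →ₗ[ℝ] ℝ, (∀ a ∈ M, 0 ≤ α (toR a)) ∧ α x = 0 ∧
      (s ∈ S \ T → 0 < α (toR s)) := fun s => by
    by_cases hs : s ∈ S \ T
    · obtain ⟨α, h₁, h₂, h₃⟩ := exists_dual_pos_of_forall_sub_smul_notMem hFG hx (s := s) (by
        simpa [T, (Finset.mem_sdiff.1 hs).1] using (Finset.mem_sdiff.1 hs).2)
      exact ⟨α, h₁, h₂, fun _ => h₃⟩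
    · exact ⟨0, by simp, by simp, fun h => absurd h hs⟩
  choose β hβM hβx hβpos using hα
  let α := ∑ s ∈ S \ T, β s
  have hαM : ∀ a ∈ M, 0 ≤ α (toR a) := fun a ha => by
    simpa [α] using Finset.sum_nonneg fun s _ => hβM s a ha
  have hαC : ∀ y ∈ coneM M, 0 ≤ α y := fun y hy => dual_nonneg_of_mem_coneM hαM hy
  have hαx : α x = 0 := by simp [α, hβx]
  have hαpos : ∀ s ∈ S, s ∉ T → 0 < α (toR s) := fun s hs hsT => by
    have hs' : s ∈ S \ T := Finset.mem_sdiff.2 ⟨hs, hsT⟩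
    simpa [α] using Finset.sum_pos' (fun t _ => hβM t s (hSM s hs)) ⟨s, hs', hβpos s hs'⟩
  have hTS : T ⊆ S := Finset.filter_subset _ _
  have hT : ∀ t : T, ∃ ε : ℝ, 0 < ε ∧ x - ε • toR t.1 ∈ coneM M := fun t =>
    (Finset.mem_filter.1 t.2).2
  choose ε hε hεC using hT
  have hαT : ∀ t : T, α (toR t.1) = 0 := fun t => by
    refine le_antisymm ?_ (hαM _ (hSM _ (hTS t.2)))
    have := hαC _ (hεC t)
    simp only [map_sub, hαx, map_smul, smul_eq_mul] at this
    by_contra! hpos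
    nlinarith [mul_pos (hε t) hpos]
  have hF : ∀ y, y ∈ {y ∈ coneM M | α y = 0} ↔
      ∃ c : T → ℝ, (∀ t, 0 ≤ c t) ∧ y = ∑ t, c t • toR t.1 := fun y => by
    constructor
    · rintro ⟨hy, hαy⟩
      obtain ⟨c, hc, rfl⟩ := exists_combination_of_mem_coneM hS
        fun f hf => dual_nonneg_of_mem_coneM hf hy
      refine ⟨fun t => c t, fun t => hc _ (hTS t.2), ?_⟩
      rw [Finset.sum_coe_sort T fun t => c t • toR t]
      refine (Finset.sum_subset hTS fun s hs hsT => ?_).symm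
      simp only [map_sum, map_smul, smul_eq_mul] at hαy
      rw [Finset.sum_eq_zero_iff_of_nonneg
        fun s hs => mul_nonneg (hc s hs) (hαM s (hSM s hs))] at hαy
      rw [(mul_eq_zero.1 (hαy s hs)).resolve_right (hαpos s hs hsT).ne', zero_smul]
    · rintro ⟨c, hc, rfl⟩
      exact ⟨sum_mem_coneM _ c (fun t => t.1) (fun t _ => hc t) fun t _ => hSM _ (hTS t.2),
        by simp [hαT]⟩
  refine ⟨α, hαC, hαx, ?_⟩
  obtain ⟨c, hc, hcx⟩ := (hF (x + ∑ t, (x - ε t • toR t.1))).1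
    ⟨(mem_coneM_iff_forall_dual hFG).2 fun f hf => by
      rw [map_add, map_sum]
      exact add_nonneg (dual_nonneg_of_mem_coneM hf hx)
        (Finset.sum_nonneg fun t _ => dual_nonneg_of_mem_coneM hf (hεC t)),
      by simp only [map_add, map_sum, map_sub, map_smul, hαx, hαT, smul_zero, sub_zero,
        Finset.sum_const_zero, add_zero]⟩
  have hxsum : x = ∑ t : T, ((c t + ε t) / (Fintype.card T + 1)) • toR t.1 := by
    have h₁ : ((Fintype.card T : ℝ) + 1) • x = ∑ t : T, (c t + ε t) • toR t.1 := by
      simp only [add_smul, Finset.sum_add_distrib, ← hcx, Finset.sum_sub_distrib]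
      simp only [Finset.sum_const, Finset.card_univ, ← Nat.cast_smul_eq_nsmul ℝ, one_smul]
      abel
    have h₂ : (Fintype.card T : ℝ) + 1 ≠ 0 := by positivity
    rw [← inv_smul_smul₀ h₂ x, h₁, Finset.smul_sum]
    exact Finset.sum_congr rfl fun t _ => by rw [smul_smul, div_eq_inv_mul]
  rw [hxsum]
  exact mem_intrinsicInterior_of_eq_sum _ hF _ fun t =>
    div_pos (add_pos_of_nonneg_of_pos (hc t) (hε t)) (by positivity)

end Cone

/-- `M` is seminormal iff for every face `F` of `cone(M)`,
`gp(M ∩ F) ∩ relint(F) ⊆ M`. -/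
theorem seminormal_iff_faces {m : ℕ} (M : AddSubmonoid (Fin m → ℤ)) (hFG : M.FG) :
    Seminormal M ↔
      ∀ F : Set (Fin m → ℝ), IsFace M F →
        ∀ z ∈ gpF M F, toR z ∈ intrinsicInterior ℝ F → z ∈ M := by
  constructor
  · intro hM F hF z hz hzF
    obtain ⟨a, ha, b, hb, hbF, -, rfl⟩ := hF.exists_sub_of_mem_gpF hz
    obtain ⟨ε, hε, hεF⟩ := exists_pos_sub_smul_mem_of_mem_intrinsicInterior
      (toR_zero (m := m) ▸ hF.toR_zero_mem) hbF hzF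
    obtain ⟨p, q, hp, hq, c, hc, h⟩ := exists_nsmul_eq_add_nsmul hε (hF.subset hεF)
    exact hM.mem_of_forall_nsmul_mem
      ((gp M).sub_mem (AddSubgroup.subset_closure ha) (AddSubgroup.subset_closure hb))
      fun k hk => nsmul_mem_of_nsmul_eq_add_nsmul ha hb hc hp hq h hk
  · intro h z _ h₂ h₃
    have hz : toR z ∈ coneM M := (mem_coneM_iff_forall_dual hFG).2 fun f hf => by
      have := hf _ h₂
      rw [toR_nsmul, map_smul, smul_eq_mul] at this
      push_cast at this
      linarith
    obtain ⟨α, hα, hαz, hzF⟩ := exists_isFace_mem_intrinsicInterior hFG hz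
    refine h _ (Or.inr ⟨α, hα, rfl⟩) z ?_ hzF
    have hz_eq : z = 3 • z - 2 • z := by module
    rw [hz_eq]
    exact AddSubgroup.sub_mem _
      (AddSubgroup.subset_closure ⟨h₃, toR_mem_coneM h₃, by rw [toR_nsmul, map_smul, hαz, smul_zero]⟩)
      (AddSubgroup.subset_closure ⟨h₂, toR_mem_coneM h₂, by rw [toR_nsmul, map_smul, hαz, smul_zero]⟩)
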